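/- Let λ ∈ ℂ \ {0,1} and let K be the pair K¹ = u₃ + (λ−1)[2(u+v)v₂ + 6u²v₁ − 12uv v₁ − 10v²v₁ + (u−v)²(u+3v)(v+3u)] + 6u u₂ + 9u₁² − 6 D_x(v u₁) + (λ+2)[−v₁² + 4(u²+v²)u₁] + 8(λ−4)uv u₁ and K² = λ v₃ + (λ−1)[2(u+v)u₂ + 10u²u₁ + 12uv u₁ − 6v²u₁ + (u−v)²(u+3v)(v+3u)] + (2λ+1)[u₁² + 4(u²+v²)v₁] + 3λ[2 D_x(u v₁) − 2v v₂ − 3v₁²] − 8(4λ−1)uv v₁. Then (i) [(x u₁ + u, x v₁ + v), K] = 3K (the system is (1,1)-homogeneous with κ = 3), and (ii) the pair τ = −(1/6)[(x²u₁ + 2xu − 1/4, x²v₁ + 2xv + 1/4), K] satisfies [τ,K] ≠ 0 and [[τ,K],K] = 0, i.e. τ is a master symmetry of the system u_t = K¹, v_t = K². -/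

import Mathlib

open MvPolynomial

/-- The two-component differential ring `𝒜₂ = ℂ[x, u₀, u₁, …, v₀, v₁, …]`:
variable `none` is `x`, `some (false, k)` is `u_k`, `some (true, k)` is `v_k`. -/
abbrev A2 : Type := MvPolynomial (Option (Bool × ℕ)) ℂ

/-- The variable `x`. -/
noncomputable def Xx : A2 := X none

/-- The variable `u_k`. -/
noncomputable def U (k : ℕ) : A2 := X (some (false, k))

/-- The variable `v_k`. -/
noncomputable def V (k : ℕ) : A2 := X (some (true, k))

/-- The total derivative `D_x = ∂/∂x + Σ_{k≥0} (u_{k+1} ∂/∂u_k + v_{k+1} ∂/∂v_k)`. -/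
noncomputable def Dx (P : A2) : A2 :=
  pderiv (none : Option (Bool × ℕ)) P +
    ∑ᶠ k : ℕ, (U (k + 1) * pderiv (some (false, k)) P +
      V (k + 1) * pderiv (some (true, k)) P)

/-- `frU P Q = P_{u*}(Q) = Σ_k (∂P/∂u_k) D_x^k(Q)`. -/
noncomputable def frU (P Q : A2) : A2 :=
  ∑ᶠ k : ℕ, pderiv (some (false, k)) P * Dx^[k] Q

/-- `frV P Q = P_{v*}(Q) = Σ_k (∂P/∂v_k) D_x^k(Q)`. -/
noncomputable def frV (P Q : A2) : A2 :=
  ∑ᶠ k : ℕ, pderiv (some (true, k)) P * Dx^[k] Q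

/-- The Lie bracket of two pairs (evolutionary vector fields). -/
noncomputable def lieBr2 (P J : A2 × A2) : A2 × A2 :=
  (frU J.1 P.1 + frV J.1 P.2 - frU P.1 J.1 - frV P.1 J.2,
   frU J.2 P.1 + frV J.2 P.2 - frU P.2 J.1 - frV P.2 J.2)

/-- The third-order Burgers flow `B₃[u] = u₃ + 3u u₂ + 3u² u₁ + 3u₁²`. -/
noncomputable def B3 : A2 := U 3 + 3 * U 0 * U 2 + 3 * U 0 ^ 2 * U 1 + 3 * U 1 ^ 2

/-- The `s`-component of the third-order flow in the variables `s = u + v`, `w = u - v`. -/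
def flow3S {R : Type*} [CommRing R] (s w : ℕ → R) : R :=
    -16 * s 0 * s 1 * w 0 - 4 * s 0 * s 2 - 16 * s 0 ^ 2 * w 0 ^ 2 - 16 * s 0 ^ 2 * w 1 +
    12 * s 1 * w 0 ^ 2 + 12 * s 1 * w 1 + s 1 ^ 2 + 6 * s 2 * w 0 + s 3 + 6 * w 0 * w 2 +
    16 * w 0 ^ 2 * w 1 + 4 * w 0 ^ 4 + 7 * w 1 ^ 2 + w 3

/-- The `w`-component of the third-order flow in the variables `s = u + v`, `w = u - v`. -/
def flow3W {R : Type*} [CommRing R] (s w : ℕ → R) : R :=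
    16 * s 0 * w 0 * w 1 + 4 * s 0 * w 2 + 8 * s 1 * w 0 ^ 2 + 10 * s 1 * w 1 + 6 * s 2 * w 0 +
    s 3 + 6 * w 0 * w 2 + 12 * w 0 ^ 2 * w 1 + 6 * w 1 ^ 2 + w 3

/-- The `s`-component of the master field of the third-order flow. -/
def masterS {R : Type*} [CommRing R] (x : R) (s w : ℕ → R) : R :=
    6 * x * flow3S s w - 12 * s 0 * s 1 + 24 * s 0 * w 0 ^ 2 + 24 * s 0 * w 1 - 48 * s 0 ^ 2 * w 0 +
    48 * s 1 * w 0 + 9 * s 2 + 48 * w 0 * w 1 + 24 * w 0 ^ 3 + 9 * w 2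

/-- The `w`-component of the master field of the third-order flow. -/
def masterW {R : Type*} [CommRing R] (x : R) (s w : ℕ → R) : R :=
    6 * x * flow3W s w + 48 * s 0 * w 0 ^ 2 + 36 * s 0 * w 1 + 48 * s 1 * w 0 + 9 * s 2 +
    48 * w 0 * w 1 + 24 * w 0 ^ 3 + 9 * w 2

/-- The `s`-component of the fifth-order flow. -/
def flow5S {R : Type*} [CommRing R] (s w : ℕ → R) : R :=
    -256 * s 0 * s 1 * w 0 * w 1 - 128 * s 0 * s 1 * w 0 ^ 3 - 48 * s 0 * s 1 * w 2 -
    96 * s 0 * s 2 * w 0 ^ 2 - 80 * s 0 * s 2 * w 1 - 32 * s 0 * s 3 * w 0 - 4 * s 0 * s 4 -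
    96 * s 0 ^ 2 * w 0 * w 2 - 256 * s 0 ^ 2 * w 0 ^ 2 * w 1 - 64 * s 0 ^ 2 * w 0 ^ 4 -
    112 * s 0 ^ 2 * w 1 ^ 2 - 16 * s 0 ^ 2 * w 3 + 4 * s 1 * s 2 * w 0 + 2 * s 1 * s 3 +
    120 * s 1 * w 0 * w 2 + 320 * s 1 * w 0 ^ 2 * w 1 + 80 * s 1 * w 0 ^ 4 + 140 * s 1 * w 1 ^ 2
    + 20 * s 1 * w 3 + 4 * s 1 ^ 2 * w 0 ^ 2 + 20 * s 1 ^ 2 * w 1 + 160 * s 2 * w 0 * w 1 +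
    80 * s 2 * w 0 ^ 3 + 30 * s 2 * w 2 - s 2 ^ 2 + 40 * s 3 * w 0 ^ 2 + 30 * s 3 * w 1 +
    10 * s 4 * w 0 + s 5 + 204 * w 0 * w 1 * w 2 + 10 * w 0 * w 4 + 276 * w 0 ^ 2 * w 1 ^ 2 +
    44 * w 0 ^ 2 * w 3 + 104 * w 0 ^ 3 * w 2 + 144 * w 0 ^ 4 * w 1 + 16 * w 0 ^ 6 +
    32 * w 1 * w 3 + 72 * w 1 ^ 3 + 19 * w 2 ^ 2 + w 5

/-- The `w`-component of the fifth-order flow. -/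
def flow5W {R : Type*} [CommRing R] (s w : ℕ → R) : R :=
    192 * s 0 * w 0 * w 1 ^ 2 + 32 * s 0 * w 0 * w 3 + 96 * s 0 * w 0 ^ 2 * w 2 +
    128 * s 0 * w 0 ^ 3 * w 1 + 80 * s 0 * w 1 * w 2 + 4 * s 0 * w 4 + 116 * s 1 * w 0 * w 2 +
    264 * s 1 * w 0 ^ 2 * w 1 + 32 * s 1 * w 0 ^ 4 + 108 * s 1 * w 1 ^ 2 + 18 * s 1 * w 3 +
    156 * s 2 * w 0 * w 1 + 56 * s 2 * w 0 ^ 3 + 32 * s 2 * w 2 + 36 * s 3 * w 0 ^ 2 +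
    28 * s 3 * w 1 + 10 * s 4 * w 0 + s 5 + 200 * w 0 * w 1 * w 2 + 10 * w 0 * w 4 +
    240 * w 0 ^ 2 * w 1 ^ 2 + 40 * w 0 ^ 2 * w 3 + 80 * w 0 ^ 3 * w 2 + 80 * w 0 ^ 4 * w 1 +
    30 * w 1 * w 3 + 60 * w 1 ^ 3 + 20 * w 2 ^ 2 + w 5

section Jets

set_option linter.unusedSimpArgs false

variable {R : Type*} [CommRing R] [Algebra ℂ R]

theorem Derivation.map_ofNat_eq_zero (D : Derivation ℂ R R) (n : ℕ) [n.AtLeastTwo] :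
    D (ofNat(n) : R) = 0 := by
  rw [← Nat.cast_ofNat]
  exact D.map_natCast n

variable {D E F : Derivation ℂ R R} {s w : ℕ → R} {x : R}

/-- The scaling field has weight three against the third-order flow. -/
theorem scaling_bracket_flow3
    (hDs : ∀ k, D (s k) = s (k + 1)) (hDw : ∀ k, D (w k) = w (k + 1)) (hDx : D x = 1)
    (hEs : ∀ k, E (s k) = D^[k] (x * s 1 + s 0)) (hEw : ∀ k, E (w k) = D^[k] (x * w 1 + w 0))
    (hFs : ∀ k, F (s k) = D^[k] (flow3S s w)) (hFw : ∀ k, F (w k) = D^[k] (flow3W s w))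
    (hFx : F x = 0) :
    E (flow3S s w) - F (x * s 1 + s 0) = 3 * flow3S s w ∧
      E (flow3W s w) - F (x * w 1 + w 0) = 3 * flow3W s w := by
  constructor <;>
  · simp only [flow3S, flow3W, map_add, map_sub, map_neg, Derivation.leibniz,
      Derivation.leibniz_pow, Derivation.map_ofNat_eq_zero, smul_eq_mul, nsmul_eq_mul,
      hEs, hEw, hFs, hFw, hFx, hDs, hDw, hDx, Function.iterate_succ_apply',
      Function.iterate_zero_apply, Derivation.map_one_eq_zero, map_zero]
    push_cast
    ring

/-- The projective field maps the third-order flow to its master field. -/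
theorem projective_bracket_flow3
    (hDs : ∀ k, D (s k) = s (k + 1)) (hDw : ∀ k, D (w k) = w (k + 1)) (hDx : D x = 1)
    (hEs : ∀ k, E (s k) = D^[k] (2 * x ^ 2 * s 1 + 4 * x * s 0))
    (hEw : ∀ k, E (w k) = D^[k] (2 * x ^ 2 * w 1 + 4 * x * w 0 - 1))
    (hFs : ∀ k, F (s k) = D^[k] (flow3S s w)) (hFw : ∀ k, F (w k) = D^[k] (flow3W s w))
    (hFx : F x = 0) :
    E (flow3S s w) - F (2 * x ^ 2 * s 1 + 4 * x * s 0) = 2 * masterS x s w ∧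
      E (flow3W s w) - F (2 * x ^ 2 * w 1 + 4 * x * w 0 - 1) = 2 * masterW x s w := by
  constructor <;>
  · simp only [masterS, masterW, flow3S, flow3W, map_add, map_sub, map_neg, Derivation.leibniz,
      Derivation.leibniz_pow, Derivation.map_ofNat_eq_zero, smul_eq_mul, nsmul_eq_mul,
      hEs, hEw, hFs, hFw, hFx, hDs, hDw, hDx, Function.iterate_succ_apply',
      Function.iterate_zero_apply, Derivation.map_one_eq_zero, map_zero, Derivation.map_natCast]
    push_cast
    ring

variable {G : Derivation ℂ R R}

set_option maxRecDepth 100000 in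
set_option maxHeartbeats 4000000 in
/-- The master field maps the third-order flow to the fifth-order one and commutes with its
reflection. -/
theorem master_bracket_flow3
    (hDs : ∀ k, D (s k) = s (k + 1)) (hDw : ∀ k, D (w k) = w (k + 1)) (hDx : D x = 1)
    (hEs : ∀ k, E (s k) = D^[k] (masterS x s w)) (hEw : ∀ k, E (w k) = D^[k] (masterW x s w))
    (hFs : ∀ k, F (s k) = D^[k] (flow3S s w)) (hFw : ∀ k, F (w k) = D^[k] (flow3W s w))
    (hGs : ∀ k, G (s k) = D^[k] (-flow3S (-s) w)) (hGw : ∀ k, G (w k) = D^[k] (flow3W (-s) w))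
    (hFx : F x = 0) (hGx : G x = 0) :
    (E (flow3S s w) - F (masterS x s w) = 36 * flow5S s w ∧
      E (flow3W s w) - F (masterW x s w) = 36 * flow5W s w) ∧
    (E (-flow3S (-s) w) - G (masterS x s w) = 0 ∧
      E (flow3W (-s) w) - G (masterW x s w) = 0) := by
  obtain ⟨a, ha⟩ : ∃ a, a = flow3S s w := ⟨_, rfl⟩
  obtain ⟨b, hb⟩ : ∃ b, b = flow3W s w := ⟨_, rfl⟩
  obtain ⟨c, hc⟩ : ∃ c, c = -flow3S (-s) w := ⟨_, rfl⟩
  obtain ⟨d, hd⟩ : ∃ d, d = flow3W (-s) w := ⟨_, rfl⟩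
  obtain ⟨e, he⟩ : ∃ e, e = masterS x s w := ⟨_, rfl⟩
  obtain ⟨f, hf⟩ : ∃ f, f = masterW x s w := ⟨_, rfl⟩
  rw [← he] at hEs
  rw [← hf] at hEw
  rw [← ha] at hFs
  rw [← hb] at hFw
  rw [← hc] at hGs
  rw [← hd] at hGw
  rw [← ha, ← hb, ← hc, ← hd, ← he, ← hf]
  simp only [masterS, masterW, flow3S, flow3W, Pi.neg_apply] at ha hb hc hd he hf
  ring_nf at ha hb hc hd he hf
  have ha1 := congrArg D ha
  have hb1 := congrArg D hb
  have hc1 := congrArg D hc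
  have hd1 := congrArg D hd
  have he1 := congrArg D he
  have hf1 := congrArg D hf
  simp only [map_add, map_sub, map_neg, Derivation.leibniz, Derivation.leibniz_pow,
    Derivation.map_ofNat_eq_zero, smul_eq_mul, nsmul_eq_mul, hDs, hDw, hDx,
    Derivation.map_one_eq_zero, map_zero, Nat.reduceAdd] at ha1 hb1 hc1 hd1 he1 hf1
  ring_nf at ha1 hb1 hc1 hd1 he1 hf1
  have ha2 := congrArg D ha1
  have hb2 := congrArg D hb1
  have hc2 := congrArg D hc1
  have hd2 := congrArg D hd1
  have he2 := congrArg D he1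
  have hf2 := congrArg D hf1
  simp only [map_add, map_sub, map_neg, Derivation.leibniz, Derivation.leibniz_pow,
    Derivation.map_ofNat_eq_zero, smul_eq_mul, nsmul_eq_mul, hDs, hDw, hDx,
    Derivation.map_one_eq_zero, map_zero, Nat.reduceAdd] at ha2 hb2 hc2 hd2 he2 hf2
  ring_nf at ha2 hb2 hc2 hd2 he2 hf2
  have ha3 := congrArg D ha2
  have hb3 := congrArg D hb2
  have hc3 := congrArg D hc2
  have hd3 := congrArg D hd2
  have he3 := congrArg D he2
  have hf3 := congrArg D hf2
  simp only [map_add, map_sub, map_neg, Derivation.leibniz, Derivation.leibniz_pow,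
    Derivation.map_ofNat_eq_zero, smul_eq_mul, nsmul_eq_mul, hDs, hDw, hDx,
    Derivation.map_one_eq_zero, map_zero, Nat.reduceAdd] at ha3 hb3 hc3 hd3 he3 hf3
  ring_nf at ha3 hb3 hc3 hd3 he3 hf3
  refine ⟨⟨?_, ?_⟩, ?_, ?_⟩
  · rw [ha, he]
    simp only [flow5S, map_add, map_sub, map_neg, Derivation.leibniz, Derivation.leibniz_pow,
      Derivation.map_ofNat_eq_zero, smul_eq_mul, nsmul_eq_mul, hFx, map_zero,
      (hEs 0).trans he, (hEs 1).trans he1, (hEs 2).trans he2, (hEs 3).trans he3,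
      (hEw 0).trans hf, (hEw 1).trans hf1, (hEw 2).trans hf2, (hEw 3).trans hf3,
      (hFs 0).trans ha, (hFs 1).trans ha1, (hFs 2).trans ha2, (hFs 3).trans ha3,
      (hFw 0).trans hb, (hFw 1).trans hb1, (hFw 2).trans hb2, (hFw 3).trans hb3]
    push_cast
    ring
  · rw [hb, hf]
    simp only [flow5W, map_add, map_sub, map_neg, Derivation.leibniz, Derivation.leibniz_pow,
      Derivation.map_ofNat_eq_zero, smul_eq_mul, nsmul_eq_mul, hFx, map_zero,
      (hEs 0).trans he, (hEs 1).trans he1, (hEs 2).trans he2, (hEs 3).trans he3,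
      (hEw 0).trans hf, (hEw 1).trans hf1, (hEw 2).trans hf2, (hEw 3).trans hf3,
      (hFs 0).trans ha, (hFs 1).trans ha1, (hFs 2).trans ha2, (hFs 3).trans ha3,
      (hFw 0).trans hb, (hFw 1).trans hb1, (hFw 2).trans hb2, (hFw 3).trans hb3]
    push_cast
    ring
  · rw [hc, he]
    simp only [map_add, map_sub, map_neg, Derivation.leibniz, Derivation.leibniz_pow,
      Derivation.map_ofNat_eq_zero, smul_eq_mul, nsmul_eq_mul, hGx, map_zero,
      (hEs 0).trans he, (hEs 1).trans he1, (hEs 2).trans he2, (hEs 3).trans he3,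
      (hEw 0).trans hf, (hEw 1).trans hf1, (hEw 2).trans hf2, (hEw 3).trans hf3,
      (hGs 0).trans hc, (hGs 1).trans hc1, (hGs 2).trans hc2, (hGs 3).trans hc3,
      (hGw 0).trans hd, (hGw 1).trans hd1, (hGw 2).trans hd2, (hGw 3).trans hd3]
    push_cast
    ring
  · rw [hd, hf]
    simp only [map_add, map_sub, map_neg, Derivation.leibniz, Derivation.leibniz_pow,
      Derivation.map_ofNat_eq_zero, smul_eq_mul, nsmul_eq_mul, hGx, map_zero,
      (hEs 0).trans he, (hEs 1).trans he1, (hEs 2).trans he2, (hEs 3).trans he3,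
      (hEw 0).trans hf, (hEw 1).trans hf1, (hEw 2).trans hf2, (hEw 3).trans hf3,
      (hGs 0).trans hc, (hGs 1).trans hc1, (hGs 2).trans hc2, (hGs 3).trans hc3,
      (hGw 0).trans hd, (hGw 1).trans hd1, (hGw 2).trans hd2, (hGw 3).trans hd3]
    push_cast
    ring

set_option maxRecDepth 100000 in
set_option maxHeartbeats 4000000 in
/-- The fifth-order flow commutes with the third-order flow and with its reflection. -/
theorem flow5_bracket_flow3
    (hDs : ∀ k, D (s k) = s (k + 1)) (hDw : ∀ k, D (w k) = w (k + 1))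
    (hEs : ∀ k, E (s k) = D^[k] (flow5S s w)) (hEw : ∀ k, E (w k) = D^[k] (flow5W s w))
    (hFs : ∀ k, F (s k) = D^[k] (flow3S s w)) (hFw : ∀ k, F (w k) = D^[k] (flow3W s w))
    (hGs : ∀ k, G (s k) = D^[k] (-flow3S (-s) w)) (hGw : ∀ k, G (w k) = D^[k] (flow3W (-s) w)) :
    (E (flow3S s w) - F (flow5S s w) = 0 ∧
      E (flow3W s w) - F (flow5W s w) = 0) ∧
    (E (-flow3S (-s) w) - G (flow5S s w) = 0 ∧
      E (flow3W (-s) w) - G (flow5W s w) = 0) := by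
  obtain ⟨a, ha⟩ : ∃ a, a = flow3S s w := ⟨_, rfl⟩
  obtain ⟨b, hb⟩ : ∃ b, b = flow3W s w := ⟨_, rfl⟩
  obtain ⟨c, hc⟩ : ∃ c, c = -flow3S (-s) w := ⟨_, rfl⟩
  obtain ⟨d, hd⟩ : ∃ d, d = flow3W (-s) w := ⟨_, rfl⟩
  obtain ⟨e, he⟩ : ∃ e, e = flow5S s w := ⟨_, rfl⟩
  obtain ⟨f, hf⟩ : ∃ f, f = flow5W s w := ⟨_, rfl⟩
  rw [← he] at hEs
  rw [← hf] at hEw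
  rw [← ha] at hFs
  rw [← hb] at hFw
  rw [← hc] at hGs
  rw [← hd] at hGw
  rw [← ha, ← hb, ← hc, ← hd, ← he, ← hf]
  simp only [flow5S, flow5W, flow3S, flow3W, Pi.neg_apply] at ha hb hc hd he hf
  ring_nf at ha hb hc hd he hf
  have ha1 := congrArg D ha
  have hb1 := congrArg D hb
  have hc1 := congrArg D hc
  have hd1 := congrArg D hd
  have he1 := congrArg D he
  have hf1 := congrArg D hf
  simp only [map_add, map_sub, map_neg, Derivation.leibniz, Derivation.leibniz_pow,
    Derivation.map_ofNat_eq_zero, smul_eq_mul, nsmul_eq_mul, hDs, hDw,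
    Nat.reduceAdd] at ha1 hb1 hc1 hd1 he1 hf1
  ring_nf at ha1 hb1 hc1 hd1 he1 hf1
  have ha2 := congrArg D ha1
  have hb2 := congrArg D hb1
  have hc2 := congrArg D hc1
  have hd2 := congrArg D hd1
  have he2 := congrArg D he1
  have hf2 := congrArg D hf1
  simp only [map_add, map_sub, map_neg, Derivation.leibniz, Derivation.leibniz_pow,
    Derivation.map_ofNat_eq_zero, smul_eq_mul, nsmul_eq_mul, hDs, hDw,
    Nat.reduceAdd] at ha2 hb2 hc2 hd2 he2 hf2
  ring_nf at ha2 hb2 hc2 hd2 he2 hf2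
  have ha3 := congrArg D ha2
  have hb3 := congrArg D hb2
  have hc3 := congrArg D hc2
  have hd3 := congrArg D hd2
  have he3 := congrArg D he2
  have hf3 := congrArg D hf2
  simp only [map_add, map_sub, map_neg, Derivation.leibniz, Derivation.leibniz_pow,
    Derivation.map_ofNat_eq_zero, smul_eq_mul, nsmul_eq_mul, hDs, hDw,
    Nat.reduceAdd] at ha3 hb3 hc3 hd3 he3 hf3
  ring_nf at ha3 hb3 hc3 hd3 he3 hf3
  have ha4 := congrArg D ha3
  have hb4 := congrArg D hb3
  have hc4 := congrArg D hc3
  have hd4 := congrArg D hd3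
  simp only [map_add, map_sub, map_neg, Derivation.leibniz, Derivation.leibniz_pow,
    Derivation.map_ofNat_eq_zero, smul_eq_mul, nsmul_eq_mul, hDs, hDw,
    Nat.reduceAdd] at ha4 hb4 hc4 hd4
  ring_nf at ha4 hb4 hc4 hd4
  have ha5 := congrArg D ha4
  have hb5 := congrArg D hb4
  have hc5 := congrArg D hc4
  have hd5 := congrArg D hd4
  simp only [map_add, map_sub, map_neg, Derivation.leibniz, Derivation.leibniz_pow,
    Derivation.map_ofNat_eq_zero, smul_eq_mul, nsmul_eq_mul, hDs, hDw,
    Nat.reduceAdd] at ha5 hb5 hc5 hd5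
  ring_nf at ha5 hb5 hc5 hd5
  refine ⟨⟨?_, ?_⟩, ?_, ?_⟩
  · rw [ha, he]
    simp only [map_add, map_sub, map_neg, Derivation.leibniz, Derivation.leibniz_pow,
      Derivation.map_ofNat_eq_zero, smul_eq_mul, nsmul_eq_mul,
      (hEs 0).trans he, (hEs 1).trans he1, (hEs 2).trans he2, (hEs 3).trans he3,
      (hEw 0).trans hf, (hEw 1).trans hf1, (hEw 2).trans hf2, (hEw 3).trans hf3,
      (hFs 0).trans ha, (hFs 1).trans ha1, (hFs 2).trans ha2, (hFs 3).trans ha3,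
        (hFs 4).trans ha4, (hFs 5).trans ha5,
      (hFw 0).trans hb, (hFw 1).trans hb1, (hFw 2).trans hb2, (hFw 3).trans hb3,
        (hFw 4).trans hb4, (hFw 5).trans hb5]
    push_cast
    ring
  · rw [hb, hf]
    simp only [map_add, map_sub, map_neg, Derivation.leibniz, Derivation.leibniz_pow,
      Derivation.map_ofNat_eq_zero, smul_eq_mul, nsmul_eq_mul,
      (hEs 0).trans he, (hEs 1).trans he1, (hEs 2).trans he2, (hEs 3).trans he3,
      (hEw 0).trans hf, (hEw 1).trans hf1, (hEw 2).trans hf2, (hEw 3).trans hf3,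
      (hFs 0).trans ha, (hFs 1).trans ha1, (hFs 2).trans ha2, (hFs 3).trans ha3,
        (hFs 4).trans ha4, (hFs 5).trans ha5,
      (hFw 0).trans hb, (hFw 1).trans hb1, (hFw 2).trans hb2, (hFw 3).trans hb3,
        (hFw 4).trans hb4, (hFw 5).trans hb5]
    push_cast
    ring
  · rw [hc, he]
    simp only [map_add, map_sub, map_neg, Derivation.leibniz, Derivation.leibniz_pow,
      Derivation.map_ofNat_eq_zero, smul_eq_mul, nsmul_eq_mul,
      (hEs 0).trans he, (hEs 1).trans he1, (hEs 2).trans he2, (hEs 3).trans he3,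
      (hEw 0).trans hf, (hEw 1).trans hf1, (hEw 2).trans hf2, (hEw 3).trans hf3,
      (hGs 0).trans hc, (hGs 1).trans hc1, (hGs 2).trans hc2, (hGs 3).trans hc3,
        (hGs 4).trans hc4, (hGs 5).trans hc5,
      (hGw 0).trans hd, (hGw 1).trans hd1, (hGw 2).trans hd2, (hGw 3).trans hd3,
        (hGw 4).trans hd4, (hGw 5).trans hd5]
    push_cast
    ring
  · rw [hd, hf]
    simp only [map_add, map_sub, map_neg, Derivation.leibniz, Derivation.leibniz_pow,
      Derivation.map_ofNat_eq_zero, smul_eq_mul, nsmul_eq_mul,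
      (hEs 0).trans he, (hEs 1).trans he1, (hEs 2).trans he2, (hEs 3).trans he3,
      (hEw 0).trans hf, (hEw 1).trans hf1, (hEw 2).trans hf2, (hEw 3).trans hf3,
      (hGs 0).trans hc, (hGs 1).trans hc1, (hGs 2).trans hc2, (hGs 3).trans hc3,
        (hGs 4).trans hc4, (hGs 5).trans hc5,
      (hGw 0).trans hd, (hGw 1).trans hd1, (hGw 2).trans hd2, (hGw 3).trans hd3,
        (hGw 4).trans hd4, (hGw 5).trans hd5]
    push_cast
    ring

end Jets

/-- The total derivative as a derivation of `A2`. -/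
noncomputable def totalDer : Derivation ℂ A2 A2 :=
  mkDerivation ℂ fun i => i.elim 1 fun p => if p.1 then V (p.2 + 1) else U (p.2 + 1)

/-- The evolutionary derivation with characteristic `P`. -/
noncomputable def evo (P : A2 × A2) : Derivation ℂ A2 A2 :=
  mkDerivation ℂ fun i => i.elim 0 fun p => totalDer^[p.2] (if p.1 then P.2 else P.1)

theorem finite_support_pderiv_mul (b : Bool) (P : A2) (g : ℕ → A2) :
    (Function.support fun k => pderiv (some (b, k)) P * g k).Finite := by
  have hinj : Function.Injective fun k : ℕ => (some (b, k) : Option (Bool × ℕ)) := by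
    intro m n h
    simpa using h
  refine (P.vars.finite_toSet.preimage hinj.injOn).subset fun k hk => ?_
  by_contra hmem
  exact hk (by simp [pderiv_eq_zero_of_notMem_vars hmem])

/-- The chain rule for derivations of `A2`. -/
theorem derivation_eq_finsum_pderiv (D : Derivation ℂ A2 A2) (P : A2) :
    D P = pderiv none P * D Xx + ∑ᶠ k, pderiv (some (false, k)) P * D (U k) +
      ∑ᶠ k, pderiv (some (true, k)) P * D (V k) := by
  obtain ⟨N, hN⟩ : ∃ N : ℕ, ∀ b k, some (b, k) ∈ P.vars → k < N := by
    refine ⟨P.vars.sup (fun i => i.elim 0 fun p => p.2) + 1, fun b k hk => ?_⟩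
    exact Nat.lt_succ_of_le (Finset.le_sup (f := fun i : Option (Bool × ℕ) =>
      i.elim 0 fun p => p.2) hk)
  have hsupp : ∀ (b : Bool) (g : ℕ → A2),
      (Function.support fun k => pderiv (some (b, k)) P * g k) ⊆ ↑(Finset.range N) := by
    intro b g k hk
    by_contra hmem
    refine hk ?_
    have : some (b, k) ∉ P.vars := fun h => hmem (by simpa using hN b k h)
    simp [pderiv_eq_zero_of_notMem_vars this]
  rw [finsum_eq_sum_of_support_subset _ (hsupp false _),
    finsum_eq_sum_of_support_subset _ (hsupp true _)]
  let E : Derivation ℂ A2 A2 := D Xx • pderiv none +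
    ∑ k ∈ Finset.range N, D (U k) • pderiv (some (false, k)) +
    ∑ k ∈ Finset.range N, D (V k) • pderiv (some (true, k))
  have hE : ∀ Q, E Q = pderiv none Q * D Xx +
      ∑ k ∈ Finset.range N, pderiv (some (false, k)) Q * D (U k) +
      ∑ k ∈ Finset.range N, pderiv (some (true, k)) Q * D (V k) := by
    intro Q
    have hsum : ∀ f : ℕ → Derivation ℂ A2 A2,
        (∑ k ∈ Finset.range N, f k) Q = ∑ k ∈ Finset.range N, f k Q := fun f =>
      (congrFun (map_sum Derivation.coeFnAddMonoidHom f (Finset.range N)) Q).trans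
        (Finset.sum_apply _ _ _)
    simp [E, hsum, mul_comm]
  rw [← hE]
  refine derivation_eq_of_forall_mem_vars fun i hi => ?_
  rw [hE]
  match i with
  | none => simp [pderiv_X, Xx]
  | some (false, k) =>
    have := hN _ _ hi
    simp [pderiv_X, U, Pi.single_apply, this]
  | some (true, k) =>
    have := hN _ _ hi
    simp [pderiv_X, V, Pi.single_apply, this]

@[simp] theorem totalDer_Xx : totalDer Xx = 1 := by simp [totalDer, Xx, mkDerivation_X]

@[simp] theorem totalDer_U (k : ℕ) : totalDer (U k) = U (k + 1) := by
  simp [totalDer, U, mkDerivation_X]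

@[simp] theorem totalDer_V (k : ℕ) : totalDer (V k) = V (k + 1) := by
  simp [totalDer, V, mkDerivation_X]

@[simp] theorem evo_Xx (P : A2 × A2) : evo P Xx = 0 := by simp [evo, Xx, mkDerivation_X]

@[simp] theorem evo_U (P : A2 × A2) (k : ℕ) : evo P (U k) = totalDer^[k] P.1 := by
  simp [evo, U, mkDerivation_X]

@[simp] theorem evo_V (P : A2 × A2) (k : ℕ) : evo P (V k) = totalDer^[k] P.2 := by
  simp [evo, V, mkDerivation_X]

theorem Dx_eq_totalDer : Dx = totalDer := by
  funext P
  rw [derivation_eq_finsum_pderiv, Dx, add_assoc, ← finsum_add_distrib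
    (finite_support_pderiv_mul false P _) (finite_support_pderiv_mul true P _)]
  simp [mul_comm]

theorem frU_add_frV (P : A2 × A2) (Q : A2) : frU Q P.1 + frV Q P.2 = evo P Q := by
  rw [derivation_eq_finsum_pderiv, frU, frV, Dx_eq_totalDer]
  simp

theorem lieBr2_eq (P J : A2 × A2) :
    lieBr2 P J = (evo P J.1 - evo J P.1, evo P J.2 - evo J P.2) := by
  simp only [lieBr2, ← frU_add_frV, sub_sub]

theorem evo_add (P Q : A2 × A2) : evo (P + Q) = evo P + evo Q := by
  refine MvPolynomial.derivation_ext fun i => ?_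
  rcases i with _ | ⟨_ | _, k⟩ <;> simp [evo, mkDerivation_X, iterate_map_add]

theorem iterate_totalDer_smul (k : ℕ) (c : ℂ) (Q : A2) :
    totalDer^[k] (c • Q) = c • totalDer^[k] Q := by
  induction k generalizing Q with
  | zero => rfl
  | succ k ih =>
    rw [Function.iterate_succ_apply, Derivation.map_smul, ih, Function.iterate_succ_apply]

theorem evo_smul (c : ℂ) (P : A2 × A2) : evo (c • P) = c • evo P := by
  refine MvPolynomial.derivation_ext fun i => ?_
  rcases i with _ | ⟨_ | _, k⟩ <;> simp [evo, mkDerivation_X, iterate_totalDer_smul]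

theorem lieBr2_add_right (P Q J : A2 × A2) : lieBr2 P (Q + J) = lieBr2 P Q + lieBr2 P J := by
  ext1 <;> simp only [lieBr2_eq, evo_add, Derivation.add_apply, map_add, Prod.fst_add,
    Prod.snd_add] <;> abel

theorem lieBr2_smul_right (c : ℂ) (P Q : A2 × A2) : lieBr2 P (c • Q) = c • lieBr2 P Q := by
  ext1 <;> simp [lieBr2_eq, evo_smul, smul_sub]

theorem lieBr2_add_left (P Q J : A2 × A2) : lieBr2 (P + Q) J = lieBr2 P J + lieBr2 Q J := by
  ext1 <;> simp only [lieBr2_eq, evo_add, Derivation.add_apply, map_add, Prod.fst_add,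
    Prod.snd_add] <;> abel

theorem lieBr2_smul_left (c : ℂ) (P Q : A2 × A2) : lieBr2 (c • P) Q = c • lieBr2 P Q := by
  ext1 <;> simp [lieBr2_eq, evo_smul, smul_sub]

/-- The jets of `ε (u + v)`. -/
noncomputable def sJet (ε : ℂ) (k : ℕ) : A2 := ε • (U k + V k)

/-- The jets of `u - v`. -/
noncomputable def wJet (k : ℕ) : A2 := U k - V k

/-- The vector field under which `ε (u + v)` and `u - v` evolve by `a` and `b`, when `ε ^ 2 = 1`. -/
noncomputable def pairOf (ε : ℂ) (a b : A2) : A2 × A2 :=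
  ((1 / 2 : ℂ) • (ε • a + b), (1 / 2 : ℂ) • (ε • a - b))

theorem totalDer_sJet (ε : ℂ) (k : ℕ) : totalDer (sJet ε k) = sJet ε (k + 1) := by
  simp [sJet]

theorem totalDer_wJet (k : ℕ) : totalDer (wJet k) = wJet (k + 1) := by
  simp [wJet]

section PairOf

variable {ε : ℂ}

theorem evo_pairOf_sJet (hε : ε * ε = 1) (a b : A2) (k : ℕ) :
    evo (pairOf ε a b) (sJet ε k) = totalDer^[k] a := by
  rw [sJet, Derivation.map_smul, map_add, evo_U, evo_V, ← iterate_map_add, ← iterate_totalDer_smul]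
  congr 1
  rw [pairOf, ← smul_add, add_add_sub_cancel, ← two_smul ℂ (ε • a), smul_smul, smul_smul, smul_smul,
    show ε * (1 / 2) * 2 * ε = 1 by linear_combination hε, one_smul]

theorem evo_pairOf_wJet (a b : A2) (k : ℕ) : evo (pairOf ε a b) (wJet k) = totalDer^[k] b := by
  rw [wJet, map_sub, evo_U, evo_V, ← iterate_map_sub]
  congr 1
  rw [pairOf]
  module

theorem lieBr2_pairOf (a b c d : A2) :
    lieBr2 (pairOf ε a b) (pairOf ε c d) =
      pairOf ε (evo (pairOf ε a b) c - evo (pairOf ε c d) a)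
        (evo (pairOf ε a b) d - evo (pairOf ε c d) b) := by
  ext1 <;> simp only [lieBr2_eq] <;> simp [pairOf] <;> module

theorem eq_pairOf (hε : ε * ε = 1) {P : A2 × A2} {a b : A2} (ha : ε • (P.1 + P.2) = a)
    (hb : P.1 - P.2 = b) : P = pairOf ε a b := by
  subst ha hb
  ext1 <;> simp only [pairOf, smul_smul, hε] <;> module

theorem pairOf_smul (c : ℂ) (a b : A2) : pairOf ε (c • a) (c • b) = c • pairOf ε a b := by
  ext1 <;> simp only [pairOf, Prod.smul_fst, Prod.smul_snd] <;> module

theorem pairOf_ofNat_mul (n : ℕ) [n.AtLeastTwo] (a b : A2) :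
    pairOf ε (ofNat(n) * a) (ofNat(n) * b) = (ofNat(n) : ℂ) • pairOf ε a b := by
  simp only [← pairOf_smul, smul_eq_C_mul, map_ofNat]

theorem pairOf_zero : pairOf ε 0 0 = 0 := by
  simp [pairOf]

theorem pairOf_neg_left (a b : A2) : pairOf (-ε) a b = pairOf ε (-a) b := by
  simp [pairOf]

theorem sJet_neg : sJet (-ε) = -sJet ε := by
  funext k
  exact neg_smul ε _

end PairOf

/-- The third-order flow; `ε = -1` gives its reflection under `u + v ↦ -(u + v)`. -/
noncomputable def flow3 (ε : ℂ) : A2 × A2 :=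
  pairOf ε (flow3S (sJet ε) wJet) (flow3W (sJet ε) wJet)

/-- The fifth-order flow; `ε = -1` gives its reflection under `u + v ↦ -(u + v)`. -/
noncomputable def flow5 (ε : ℂ) : A2 × A2 :=
  pairOf ε (flow5S (sJet ε) wJet) (flow5W (sJet ε) wJet)

/-- The master field of `flow3 ε`. -/
noncomputable def masterField (ε : ℂ) : A2 × A2 :=
  pairOf ε (masterS Xx (sJet ε) wJet) (masterW Xx (sJet ε) wJet)

theorem flow3_neg (ε : ℂ) : flow3 (-ε) =
    pairOf ε (-flow3S (-sJet ε) wJet) (flow3W (-sJet ε) wJet) := by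
  rw [flow3, pairOf_neg_left, sJet_neg]

section Brackets

variable {ε : ℂ}

theorem lieBr2_scaling_flow3 (hε : ε * ε = 1) :
    lieBr2 (Xx * U 1 + U 0, Xx * V 1 + V 0) (flow3 ε) = (3 : ℂ) • flow3 ε := by
  have h : ((Xx * U 1 + U 0, Xx * V 1 + V 0) : A2 × A2) =
      pairOf ε (Xx * sJet ε 1 + sJet ε 0) (Xx * wJet 1 + wJet 0) := by
    refine eq_pairOf hε ?_ ?_ <;> simp only [sJet, wJet, smul_eq_C_mul] <;> ring
  have hb := scaling_bracket_flow3 (totalDer_sJet ε) totalDer_wJet totalDer_Xx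
    (evo_pairOf_sJet hε _ _) (evo_pairOf_wJet _ _) (evo_pairOf_sJet hε _ _)
    (evo_pairOf_wJet _ _) (evo_Xx (flow3 ε))
  rw [h, flow3, lieBr2_pairOf, hb.1, hb.2, pairOf_ofNat_mul]

theorem lieBr2_projective_flow3 (hε : ε * ε = 1) :
    lieBr2 (Xx ^ 2 * U 1 + 2 * Xx * U 0 - C (1 / 4), Xx ^ 2 * V 1 + 2 * Xx * V 0 + C (1 / 4))
      (flow3 ε) = masterField ε := by
  have h : (2 : ℂ) • ((Xx ^ 2 * U 1 + 2 * Xx * U 0 - C (1 / 4),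
      Xx ^ 2 * V 1 + 2 * Xx * V 0 + C (1 / 4)) : A2 × A2) =
      pairOf ε (2 * Xx ^ 2 * sJet ε 1 + 4 * Xx * sJet ε 0)
        (2 * Xx ^ 2 * wJet 1 + 4 * Xx * wJet 0 - 1) := by
    have hC : (4 : A2) * C (1 / 4) = 1 := by
      rw [← map_ofNat (C : ℂ →+* A2) 4, ← C_mul]
      norm_num
    refine eq_pairOf hε ?_ ?_ <;>
      simp only [sJet, wJet, smul_eq_C_mul, Prod.smul_fst, Prod.smul_snd, map_ofNat]
    · ring
    · linear_combination -hC
  have hb := projective_bracket_flow3 (totalDer_sJet ε) totalDer_wJet totalDer_Xx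
    (evo_pairOf_sJet hε _ _) (evo_pairOf_wJet _ _) (evo_pairOf_sJet hε _ _)
    (evo_pairOf_wJet _ _) (evo_Xx (flow3 ε))
  have h2 := lieBr2_pairOf (ε := ε) (2 * Xx ^ 2 * sJet ε 1 + 4 * Xx * sJet ε 0)
    (2 * Xx ^ 2 * wJet 1 + 4 * Xx * wJet 0 - 1) (flow3S (sJet ε) wJet) (flow3W (sJet ε) wJet)
  rw [hb.1, hb.2, pairOf_ofNat_mul, ← h, lieBr2_smul_left] at h2
  exact smul_right_injective _ two_ne_zero h2

theorem lieBr2_masterField_flow3 (hε : ε * ε = 1) :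
    lieBr2 (masterField ε) (flow3 ε) = (36 : ℂ) • flow5 ε ∧
      lieBr2 (masterField ε) (flow3 (-ε)) = 0 := by
  have hb := master_bracket_flow3 (totalDer_sJet ε) totalDer_wJet totalDer_Xx
    (evo_pairOf_sJet hε _ _) (evo_pairOf_wJet _ _) (evo_pairOf_sJet hε _ _)
    (evo_pairOf_wJet _ _) (evo_pairOf_sJet hε _ _) (evo_pairOf_wJet _ _) (evo_Xx _) (evo_Xx _)
  rw [flow3_neg, masterField, flow3, lieBr2_pairOf, lieBr2_pairOf, hb.1.1, hb.1.2, hb.2.1, hb.2.2,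
    pairOf_ofNat_mul, pairOf_zero]
  exact ⟨rfl, rfl⟩

theorem lieBr2_flow5_flow3 (hε : ε * ε = 1) :
    lieBr2 (flow5 ε) (flow3 ε) = 0 ∧ lieBr2 (flow5 ε) (flow3 (-ε)) = 0 := by
  have hb := flow5_bracket_flow3 (totalDer_sJet ε) totalDer_wJet
    (evo_pairOf_sJet hε _ _) (evo_pairOf_wJet _ _) (evo_pairOf_sJet hε _ _)
    (evo_pairOf_wJet _ _) (evo_pairOf_sJet hε _ _) (evo_pairOf_wJet _ _)
  rw [flow3_neg, flow5, flow3, lieBr2_pairOf, lieBr2_pairOf, hb.1.1, hb.1.2, hb.2.1, hb.2.2,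
    pairOf_zero]
  exact ⟨rfl, rfl⟩

end Brackets

theorem eq_half_smul_pairOf {l : ℂ} {K : A2 × A2} {a b c d : A2}
    (h₁ : 4 * K.1 = a + b + C l * (d - c)) (h₂ : 4 * K.2 = a - b - C l * (d + c)) :
    K = (1 / 2 : ℂ) • (pairOf 1 a b + l • pairOf (-1) c d) := by
  have h4 : ∀ P : A2, (1 / 4 : ℂ) • (4 * P) = P := fun P => by
    rw [← map_ofNat (C : ℂ →+* A2) 4, C_mul', smul_smul]
    norm_num
  ext1
  · rw [← h4 K.1, h₁, C_mul']
    simp only [pairOf, Prod.smul_fst, Prod.fst_add]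
    module
  · rw [← h4 K.2, h₂, C_mul']
    simp only [pairOf, Prod.smul_snd, Prod.snd_add]
    module

theorem flow5_add_smul_ne_zero (c : ℂ) : flow5 1 + c • flow5 (-1) ≠ 0 := by
  intro h
  have := congrArg (fun P => eval (fun i => if i = some (false, 5) then (1 : ℂ) else 0) P.1) h
  simp [flow5, pairOf, flow5S, flow5W, sJet, wJet, U, V, smul_eval] at this

/-- The system from Example 5 (Wang et al.) is (1,1)-homogeneous with `κ = 3`,
and `τ = −(1/6)[(x²u₁ + 2xu − 1/4, x²v₁ + 2xv + 1/4), K]` is a master symmetry: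
`[τ,K] ≠ 0` and `[[τ,K],K] = 0`. -/
theorem systemNew13_homogeneous_and_master_symmetry (l : ℂ) (hl0 : l ≠ 0) (hl1 : l ≠ 1) :
    let q : A2 := (U 0 - V 0) ^ 2 * (U 0 + 3 * V 0) * (V 0 + 3 * U 0)
    let K : A2 × A2 :=
      (U 3 + C (l - 1) * (2 * (U 0 + V 0) * V 2 + 6 * U 0 ^ 2 * V 1 -
           12 * U 0 * V 0 * V 1 - 10 * V 0 ^ 2 * V 1 + q) +
         6 * U 0 * U 2 + 9 * U 1 ^ 2 - 6 * Dx (V 0 * U 1) +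
         C (l + 2) * (-(V 1 ^ 2) + 4 * (U 0 ^ 2 + V 0 ^ 2) * U 1) +
         C (8 * (l - 4)) * U 0 * V 0 * U 1,
       C l * V 3 + C (l - 1) * (2 * (U 0 + V 0) * U 2 + 10 * U 0 ^ 2 * U 1 +
           12 * U 0 * V 0 * U 1 - 6 * V 0 ^ 2 * U 1 + q) +
         C (2 * l + 1) * (U 1 ^ 2 + 4 * (U 0 ^ 2 + V 0 ^ 2) * V 1) +
         C (3 * l) * (2 * Dx (U 0 * V 1) - 2 * V 0 * V 2 - 3 * V 1 ^ 2) -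
         C (8 * (4 * l - 1)) * U 0 * V 0 * V 1)
    let τ : A2 × A2 := -((1 / 6 : ℂ) •
      lieBr2 (Xx ^ 2 * U 1 + 2 * Xx * U 0 - C (1 / 4),
              Xx ^ 2 * V 1 + 2 * Xx * V 0 + C (1 / 4)) K)
    lieBr2 (Xx * U 1 + U 0, Xx * V 1 + V 0) K = (3 * K.1, 3 * K.2) ∧
    lieBr2 τ K ≠ 0 ∧ lieBr2 (lieBr2 τ K) K = 0 := by
  intro q K τ
  have hone : (1 : ℂ) * 1 = 1 := one_mul 1
  have hneg : (-1 : ℂ) * -1 = 1 := by norm_num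
  have hK : K = (1 / 2 : ℂ) • (flow3 1 + l • flow3 (-1)) := by
    apply eq_half_smul_pairOf <;>
    · simp only [K, q, Dx_eq_totalDer, flow3S, flow3W, sJet, wJet, Derivation.leibniz,
        totalDer_U, totalDer_V, smul_eq_mul, C_add, C_sub, C_mul, map_ofNat, C_1, one_smul,
        neg_smul]
      ring
  have hτ : τ = (-(1 / 12) : ℂ) • (masterField 1 + l • masterField (-1)) := by
    simp only [τ, hK, lieBr2_smul_right, lieBr2_add_right, lieBr2_projective_flow3 hone,
      lieBr2_projective_flow3 hneg]
    module
  have hm₁ := lieBr2_masterField_flow3 hone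
  have hm₂ := lieBr2_masterField_flow3 hneg
  have hf₁ := lieBr2_flow5_flow3 hone
  have hf₂ := lieBr2_flow5_flow3 hneg
  rw [neg_neg] at hm₂ hf₂
  have hτK : lieBr2 τ K = (-(3 / 2) : ℂ) • (flow5 1 + (l * l) • flow5 (-1)) := by
    simp only [hτ, hK, lieBr2_smul_right, lieBr2_add_right, lieBr2_smul_left, lieBr2_add_left,
      hm₁.1, hm₁.2, hm₂.1, hm₂.2]
    module
  refine ⟨?_, ?_, ?_⟩
  · have h3 : ((3 * K.1, 3 * K.2) : A2 × A2) = (3 : ℂ) • K := by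
      ext1 <;> simp only [Prod.smul_fst, Prod.smul_snd, smul_eq_C_mul, map_ofNat]
    rw [h3, hK]
    simp only [lieBr2_smul_right, lieBr2_add_right, lieBr2_scaling_flow3 hone,
      lieBr2_scaling_flow3 hneg]
    module
  · rw [hτK]
    exact smul_ne_zero (by norm_num) (flow5_add_smul_ne_zero _)
  · rw [hτK, hK]
    simp only [lieBr2_smul_right, lieBr2_add_right, lieBr2_smul_left, lieBr2_add_left,
      hf₁.1, hf₁.2, hf₂.1, hf₂.2, smul_zero, add_zero]
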